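/- arXiv:2507.19886 — 4 statements merged into one kernel-verified Lean document; each statement's English description precedes it below -/
import Mathlib

section
/- Let μ1, μ2 ∈ D(Proc) be finitely supported distributions and p ∈ [0,1]. If μ1 →π1 ν1 and μ2 →π2 ν2 are probabilistic transition sequences, then there exists a word π with |π| ≤ |π1| + |π2| such that p·μ1 + (1−p)·μ2 →π p·ν1 + (1−p)·ν2. -/
open scoped Classical

/-- Finitely supported probability distributions on `α`. -/
structure FinDist (α : Type) where
  toFun : α → ℝ
  nonneg : ∀ a, 0 ≤ toFun a
  finite_support : (Function.support toFun).Finite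
  sum_one : ∑ᶠ a, toFun a = 1

namespace FinDist

/-- The probability that a predicate (set) `φ` is satisfied under `μ`. -/
noncomputable def mass {α : Type} (μ : FinDist α) (φ : Set α) : ℝ :=
  ∑ᶠ a ∈ φ, μ.toFun a

end FinDist

section Transitions

variable {Proc Act : Type}

/-- A single probabilistic transition between distributions: `μ →(α,p) ν` iff
`0 < p ≤ 1` and there are `P ∈ supp μ` and `ρ` with `P →α ρ` (single-step relation
`step`) and `ν = μ + μ(P)·p·(ρ − δ_P)`. -/
def DStep (step : Proc → Act → FinDist Proc → Prop)
    (μ : FinDist Proc) (α : Act) (p : ℝ) (ν : FinDist Proc) : Prop :=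
  0 < p ∧ p ≤ 1 ∧
    ∃ P ρ, 0 < μ.toFun P ∧ step P α ρ ∧
      ∀ Q, ν.toFun Q = μ.toFun Q + μ.toFun P * p * (ρ.toFun Q - (if Q = P then 1 else 0))

/-- Probabilistic transition sequence `μ →π ν` along a word `π`. -/
def DSeq (step : Proc → Act → FinDist Proc → Prop) :
    FinDist Proc → List (Act × ℝ) → FinDist Proc → Prop
  | μ, [], ν => ν = μ
  | μ, s :: π, ν => ∃ μ', DStep step μ s.1 s.2 μ' ∧ DSeq step μ' π ν

end Transitions

theorem FinDist.ext_fun {α : Type} {μ ν : FinDist α} (h : ∀ Q, μ.toFun Q = ν.toFun Q) : μ = ν := by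
  cases μ; cases ν
  have := funext h
  simp only at this
  subst this
  rfl

theorem FinDist.exists_mix {α : Type} (μ ν : FinDist α) (p : ℝ) (hp0 : 0 ≤ p) (hp1 : p ≤ 1) :
    ∃ κ : FinDist α, ∀ Q, κ.toFun Q = p * μ.toFun Q + (1 - p) * ν.toFun Q := by
  have f1 : (Function.support (fun a => p * μ.toFun a)).Finite :=
    μ.finite_support.subset (by intro a ha; simp at ha ⊢; tauto)
  have f2 : (Function.support (fun a => (1 - p) * ν.toFun a)).Finite :=
    ν.finite_support.subset (by intro a ha; simp at ha ⊢; tauto)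
  refine ⟨⟨fun Q => p * μ.toFun Q + (1 - p) * ν.toFun Q, ?_, ?_, ?_⟩, fun _ => rfl⟩
  · intro a
    have := μ.nonneg a
    have := ν.nonneg a
    have : 0 ≤ 1 - p := by linarith
    positivity
  · exact (f1.union f2).subset (Function.support_add _ _)
  · rw [finsum_add_distrib f1 f2, ← mul_finsum,
      ← mul_finsum, μ.sum_one, ν.sum_one]
    ring

theorem mix_left {Proc Act : Type} (step : Proc → Act → FinDist Proc → Prop)
    (κ : FinDist Proc) (p : ℝ) (hp0 : 0 ≤ p) (hp1 : p ≤ 1) (π1 : List (Act × ℝ)) :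
    ∀ (μ1 ν1 μ ν : FinDist Proc), DSeq step μ1 π1 ν1 →
    (∀ Q, μ.toFun Q = p * μ1.toFun Q + (1 - p) * κ.toFun Q) →
    (∀ Q, ν.toFun Q = p * ν1.toFun Q + (1 - p) * κ.toFun Q) →
    ∃ π : List (Act × ℝ), π.length ≤ π1.length ∧ DSeq step μ π ν := by
  rcases hp0.eq_or_lt with rfl | hp
  · intro μ1 ν1 μ ν _ hμ hν
    exact ⟨[], by simp, FinDist.ext_fun fun Q => by rw [hμ, hν]; ring⟩
  induction π1 with
  | nil =>
    intro μ1 ν1 μ ν h hμ hν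
    have h : ν1 = μ1 := h
    subst h
    exact ⟨[], by simp, FinDist.ext_fun fun Q => by rw [hμ, hν]⟩
  | cons s π1 ih =>
    intro μ1 ν1 μ ν h hμ hν
    obtain ⟨μ1', ⟨hq0, hq1, P, ρ, hP, hst, he⟩, hs⟩ := h
    obtain ⟨μ', hμ'⟩ := FinDist.exists_mix μ1' κ p hp0 hp1
    obtain ⟨π, hl, hπ⟩ := ih μ1' ν1 μ' ν hs hμ' hν
    have hle : p * μ1.toFun P ≤ μ.toFun P := by
      rw [hμ]
      have := mul_nonneg (sub_nonneg.2 hp1) (κ.nonneg P)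
      linarith
    have hpp : 0 < p * μ1.toFun P := mul_pos hp hP
    have hm : 0 < μ.toFun P := hpp.trans_le hle
    refine ⟨(s.1, p * μ1.toFun P * s.2 / μ.toFun P) :: π, by simpa using hl, μ',
      ⟨by positivity, ?_, P, ρ, hm, hst, ?_⟩, hπ⟩
    · show p * μ1.toFun P * s.2 / μ.toFun P ≤ 1
      rw [div_le_one hm]
      nlinarith
    · intro Q
      show _ = _ + _ * (p * μ1.toFun P * s.2 / μ.toFun P) * _
      rw [mul_div_cancel₀ _ hm.ne', hμ', he, hμ Q]
      ring

theorem DSeq.append {Proc Act : Type} {step : Proc → Act → FinDist Proc → Prop}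
    {κ ν : FinDist Proc} {π' : List (Act × ℝ)} (h' : DSeq step κ π' ν) (π : List (Act × ℝ)) :
    ∀ μ, DSeq step μ π κ → DSeq step μ (π ++ π') ν := by
  induction π with
  | nil =>
    intro μ h
    have h : κ = μ := h
    subst h
    exact h'
  | cons s π ih =>
    rintro μ ⟨μ', h1, h2⟩
    exact ⟨μ', h1, ih μ' h2⟩

/-- If `μ1 →π1 ν1` and `μ2 →π2 ν2`, then the convex combination
`p·μ1 + (1−p)·μ2` can perform a probabilistic transition sequence along a word `π`
with `|π| ≤ |π1| + |π2|` reaching `p·ν1 + (1−p)·ν2`. -/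
theorem convex_combination_of_transition_sequences
    {Proc Act : Type} (step : Proc → Act → FinDist Proc → Prop)
    (μ1 μ2 ν1 ν2 μ ν : FinDist Proc) (p : ℝ) (hp0 : 0 ≤ p) (hp1 : p ≤ 1)
    (π1 π2 : List (Act × ℝ))
    (h1 : DSeq step μ1 π1 ν1) (h2 : DSeq step μ2 π2 ν2)
    (hμ : ∀ Q, μ.toFun Q = p * μ1.toFun Q + (1 - p) * μ2.toFun Q)
    (hν : ∀ Q, ν.toFun Q = p * ν1.toFun Q + (1 - p) * ν2.toFun Q) :
    ∃ π : List (Act × ℝ), π.length ≤ π1.length + π2.length ∧ DSeq step μ π ν := by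
  obtain ⟨κ, hκ⟩ := FinDist.exists_mix ν1 μ2 p hp0 hp1
  obtain ⟨π, hl, hπ⟩ := mix_left step μ2 p hp0 hp1 π1 μ1 ν1 μ κ h1 hμ hκ
  obtain ⟨π', hl', hπ'⟩ := mix_left step ν1 (1 - p) (by linarith) (by linarith) π2 μ2 ν2 κ ν h2
    (fun Q => by rw [hκ]; ring) (fun Q => by rw [hν]; ring)
  exact ⟨π ++ π', by rw [List.length_append]; omega, DSeq.append hπ' π μ hπ⟩
end

section
/- Let μ1, μ2 ∈ D(Proc) be finitely supported distributions and p ∈ [0,1]. If p·μ1 + (1−p)·μ2 →π ν is a probabilistic transition sequence, then there exist distributions ν1, ν2 and words π1, π2 with |π1| ≤ |π| and |π2| ≤ |π| such that μ1 →π1 ν1, μ2 →π2 ν2, and ν = p·ν1 + (1−p)·ν2. -/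
open scoped Classical

theorem exists_update {Proc Act : Type} (step : Proc → Act → FinDist Proc → Prop)
    (μ ρ : FinDist Proc) (α : Act) (q : ℝ) (hq0 : 0 < q) (hq1 : q ≤ 1) (P : Proc)
    (hs : step P α ρ) :
    ∃ μ' : FinDist Proc, (μ' = μ ∨ DStep step μ α q μ') ∧
      ∀ Q, μ'.toFun Q = μ.toFun Q + μ.toFun P * q * (ρ.toFun Q - (if Q = P then 1 else 0)) := by
  rcases (μ.nonneg P).eq_or_lt with h0 | hpos
  · exact ⟨μ, Or.inl rfl, fun Q => by rw [← h0]; ring⟩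
  have hd : (Function.support (fun Q : Proc => if Q = P then (1 : ℝ) else 0)).Finite := by
    refine (Set.finite_singleton P).subset fun Q hQ => ?_
    by_contra hne
    exact hQ (if_neg hne)
  have hsub : (Function.support
      (fun Q => ρ.toFun Q - (if Q = P then (1 : ℝ) else 0))).Finite :=
    (ρ.finite_support.union hd).subset (Function.support_sub _ _)
  have hmul : (Function.support (fun Q => μ.toFun P * q *
      (ρ.toFun Q - (if Q = P then (1 : ℝ) else 0)))).Finite :=
    hsub.subset fun Q hQ h => hQ (by
      have h' : ρ.toFun Q - (if Q = P then (1 : ℝ) else 0) = 0 := h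
      simp only [h', mul_zero])
  have hd1 : ∑ᶠ Q : Proc, (if Q = P then (1 : ℝ) else 0) = 1 := by
    rw [finsum_eq_single _ P (fun Q hQ => if_neg hQ), if_pos rfl]
  let μ' : FinDist Proc :=
    { toFun := fun Q => μ.toFun Q + μ.toFun P * q * (ρ.toFun Q - (if Q = P then 1 else 0))
      nonneg := by
        intro Q
        have hr := ρ.nonneg Q
        have h1 : 0 ≤ μ.toFun P * q * ρ.toFun Q := by positivity
        by_cases hQ : Q = P
        · subst hQ
          simp only [if_true]
          nlinarith
        · simp only [if_neg hQ, sub_zero]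
          exact add_nonneg (μ.nonneg Q) h1
      finite_support := (μ.finite_support.union hmul).subset (Function.support_add _ _)
      sum_one := by
        rw [finsum_add_distrib μ.finite_support hmul, ← mul_finsum' _ _ hsub,
          finsum_sub_distrib ρ.finite_support hd, hd1, ρ.sum_one, μ.sum_one]
        ring }
  exact ⟨μ', Or.inr ⟨hq0, hq1, P, ρ, hpos, hs, fun Q => rfl⟩, fun Q => rfl⟩

theorem dseq_extend {Proc Act : Type} (step : Proc → Act → FinDist Proc → Prop)
    (μ μ' ν : FinDist Proc) (s : Act × ℝ) (π : List (Act × ℝ)) (n : ℕ)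
    (h : μ' = μ ∨ DStep step μ s.1 s.2 μ') (hn : π.length ≤ n) (hseq : DSeq step μ' π ν) :
    ∃ π' : List (Act × ℝ), π'.length ≤ n + 1 ∧ DSeq step μ π' ν := by
  rcases h with rfl | h
  · exact ⟨π, by omega, hseq⟩
  · exact ⟨s :: π, by simpa using hn, μ', h, hseq⟩

/-- If `p·μ1 + (1−p)·μ2 →π ν`, then there are `ν1, ν2` and words
`π1, π2` with `|π1| ≤ |π|`, `|π2| ≤ |π|` such that `μ1 →π1 ν1`, `μ2 →π2 ν2` and
`ν = p·ν1 + (1−p)·ν2`. -/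
theorem decomposition_of_transition_sequences
    {Proc Act : Type} (step : Proc → Act → FinDist Proc → Prop)
    (μ1 μ2 μ ν : FinDist Proc) (p : ℝ) (hp0 : 0 ≤ p) (hp1 : p ≤ 1)
    (π : List (Act × ℝ))
    (hμ : ∀ Q, μ.toFun Q = p * μ1.toFun Q + (1 - p) * μ2.toFun Q)
    (h : DSeq step μ π ν) :
    ∃ (ν1 ν2 : FinDist Proc) (π1 π2 : List (Act × ℝ)),
      π1.length ≤ π.length ∧ π2.length ≤ π.length ∧
      DSeq step μ1 π1 ν1 ∧ DSeq step μ2 π2 ν2 ∧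
      ∀ Q, ν.toFun Q = p * ν1.toFun Q + (1 - p) * ν2.toFun Q := by
  induction π generalizing μ1 μ2 μ with
  | nil =>
    have h' : ν = μ := h
    subst h'
    exact ⟨μ1, μ2, [], [], le_rfl, le_rfl, rfl, rfl, hμ⟩
  | cons s π ih =>
    obtain ⟨μ', ⟨hq0, hq1, P, ρ, -, hs, hμ'⟩, hseq⟩ := h
    obtain ⟨μ1', h1, e1⟩ := exists_update step μ1 ρ s.1 s.2 hq0 hq1 P hs
    obtain ⟨μ2', h2, e2⟩ := exists_update step μ2 ρ s.1 s.2 hq0 hq1 P hs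
    obtain ⟨ν1, ν2, π1, π2, l1, l2, d1, d2, e⟩ := ih μ1' μ2' μ'
      (fun Q => by rw [hμ', e1, e2, hμ, hμ]; ring) hseq
    obtain ⟨π1', l1', d1'⟩ := dseq_extend step μ1 μ1' ν1 s π1 _ h1 l1 d1
    obtain ⟨π2', l2', d2'⟩ := dseq_extend step μ2 μ2' ν2 s π2 _ h2 l2 d2
    exact ⟨ν1, ν2, π1', π2', l1', l2', d1', d2', e⟩
end

section
/- Let φ ⊆ Proc be a predicate and μ, ν ∈ D(Proc) distributions. If μ ⇝ ν, then there exist distributions ν1, ν2 ∈ D(Proc) such that μ →τ* ν1 and μ →τ* ν2 (internal transition sequences with degenerate witnesses) and ν1(φ) ≤ ν(φ) ≤ ν2(φ). -/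
open scoped Classical

section Testing

variable {Proc Act : Type}

/-- Internal transition sequence `μ ⇝ ν`: a finite composition of `→(τ,p)` steps. -/
def Internal (step : Proc → Act → FinDist Proc → Prop) (tau : Act)
    (μ ν : FinDist Proc) : Prop :=
  ∃ π : List (Act × ℝ), (∀ s ∈ π, s.1 = tau) ∧ DSeq step μ π ν

/-- Internal transition sequence with a degenerate witness (`every step has p = 1`),
written `μ →τ* ν`. -/
def Degenerate (step : Proc → Act → FinDist Proc → Prop) (tau : Act)
    (μ ν : FinDist Proc) : Prop :=
  ∃ π : List (Act × ℝ), (∀ s ∈ π, s.1 = tau ∧ s.2 = 1) ∧ DSeq step μ π ν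

/-- Testing outcomes `O^μ_φ = { ν(φ) : μ ⇝ ν }`. -/
def Outcomes (step : Proc → Act → FinDist Proc → Prop) (tau : Act)
    (φ : Set Proc) (μ : FinDist Proc) : Set ℝ :=
  {x | ∃ ν, Internal step tau μ ν ∧ x = ν.mass φ}

end Testing

theorem exp_step_aux {Proc : Type} (μ ρ : FinDist Proc) (P : Proc) (c : ℝ) (h : Proc → ℝ) :
    ∑ᶠ Q, (μ.toFun Q + c * (ρ.toFun Q - (if Q = P then 1 else 0))) * h Q
      = ∑ᶠ Q, μ.toFun Q * h Q + c * (∑ᶠ Q, ρ.toFun Q * h Q - h P) := by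
  have e1 : ∀ Q, (μ.toFun Q + c * (ρ.toFun Q - (if Q = P then 1 else 0))) * h Q
      = (μ.toFun Q * h Q + c * (ρ.toFun Q * h Q)) - (if Q = P then c * h P else 0) := by
    intro Q
    split_ifs with hq
    · subst hq; ring
    · ring
  have f1 : (Function.support fun Q => μ.toFun Q * h Q).Finite :=
    μ.finite_support.subset fun Q hQ hz => hQ (by simp [hz])
  have f3 : (Function.support fun Q => c * (ρ.toFun Q * h Q)).Finite :=
    ρ.finite_support.subset fun Q hQ hz => hQ (by simp [hz])
  have f4 : (Function.support fun Q => if Q = P then c * h P else 0).Finite :=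
    (Set.finite_singleton P).subset fun Q hQ => by
      by_contra hne
      exact hQ (by simp only [Set.mem_singleton_iff] at hne; simp [hne])
  have f5 : (Function.support fun Q => μ.toFun Q * h Q + c * (ρ.toFun Q * h Q)).Finite :=
    (f1.union f3).subset (Function.support_add _ _)
  rw [finsum_congr e1, finsum_sub_distrib f5 f4, finsum_add_distrib f1 f3, ← mul_finsum,
    finsum_eq_single (fun Q => if Q = P then c * h P else 0) P (by intro x hx; simp [hx])]
  simp; ring

theorem exists_full_step {Proc : Type} (μ ρ : FinDist Proc) (P : Proc) :
    ∃ ν : FinDist Proc, ∀ Q, ν.toFun Q =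
      μ.toFun Q + μ.toFun P * 1 * (ρ.toFun Q - (if Q = P then 1 else 0)) := by
  refine ⟨⟨fun Q => μ.toFun Q + μ.toFun P * 1 * (ρ.toFun Q - (if Q = P then 1 else 0)),
    ?_, ?_, ?_⟩, fun Q => rfl⟩
  · intro Q
    have h1 := mul_nonneg (μ.nonneg P) (ρ.nonneg Q)
    have h2 := μ.nonneg Q
    split_ifs with hq
    · subst hq; linarith
    · linarith
  · refine ((μ.finite_support.union ρ.finite_support).union (Set.finite_singleton P)).subset ?_
    intro Q hQ
    by_contra hn
    simp only [Set.mem_union, Function.mem_support, Set.mem_singleton_iff, not_or, not_not] at hn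
    exact hQ (by simp [hn.1.1, hn.1.2, hn.2])
  · have := exp_step_aux μ ρ P (μ.toFun P * 1) (fun _ => 1)
    simp only [mul_one, μ.sum_one, ρ.sum_one, sub_self, mul_zero, add_zero] at this
    simpa only [mul_one] using this

theorem exp_step {Proc : Type} {μ ν ρ : FinDist Proc} {P : Proc} {p : ℝ}
    (hν : ∀ Q, ν.toFun Q = μ.toFun Q + μ.toFun P * p * (ρ.toFun Q - (if Q = P then 1 else 0)))
    (h : Proc → ℝ) :
    ∑ᶠ Q, ν.toFun Q * h Q = ∑ᶠ Q, μ.toFun Q * h Q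
      + μ.toFun P * p * (∑ᶠ Q, ρ.toFun Q * h Q - h P) := by
  rw [← exp_step_aux]
  exact finsum_congr fun Q => by rw [hν]

theorem exp_update {Proc : Type} (μ : FinDist Proc) (P : Proc) (h : Proc → ℝ) (d : ℝ) :
    ∑ᶠ Q, μ.toFun Q * (h Q + if Q = P then d else 0)
      = ∑ᶠ Q, μ.toFun Q * h Q + μ.toFun P * d := by
  have f1 : (Function.support fun Q => μ.toFun Q * h Q).Finite :=
    μ.finite_support.subset fun Q hQ hz => hQ (by simp [hz])
  have f2 : (Function.support fun Q => μ.toFun Q * if Q = P then d else 0).Finite :=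
    μ.finite_support.subset fun Q hQ hz => hQ (by simp [hz])
  simp only [mul_add]
  rw [finsum_add_distrib f1 f2]
  congr 1
  rw [finsum_eq_single _ P (by intro x hx; simp [hx])]
  simp

theorem upper_aux {Proc Act : Type} (step : Proc → Act → FinDist Proc → Prop) (tau : Act)
    {μ ν : FinDist Proc}
    (hs : Relation.ReflTransGen (fun a b => ∃ p, DStep step a tau p b) μ ν) :
    ∀ h : Proc → ℝ, ∃ ν2, Relation.ReflTransGen (fun a b => DStep step a tau 1 b) μ ν2 ∧
      ∑ᶠ Q, ν.toFun Q * h Q ≤ ∑ᶠ Q, ν2.toFun Q * h Q := by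
  induction hs with
  | refl => exact fun h => ⟨μ, .refl, le_rfl⟩
  | @tail ν' ν _ hst ih =>
    intro h
    obtain ⟨p, hp0, hp1, P, ρ, hP, hPρ, hν⟩ := hst
    rw [exp_step hν h]
    set d := ∑ᶠ Q, ρ.toFun Q * h Q - h P with hd
    rcases le_total d 0 with hneg | hpos
    · obtain ⟨ν2, h2, hle⟩ := ih h
      refine ⟨ν2, h2, ?_⟩
      nlinarith [mul_nonneg (mul_pos hP hp0).le (neg_nonneg.2 hneg)]
    · obtain ⟨ν2, h2, hle⟩ := ih (fun Q => h Q + if Q = P then d else 0)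
      rw [exp_update, exp_update] at hle
      have key : ν'.toFun P * p * d ≤ ν'.toFun P * d := by
        have := mul_nonneg (mul_nonneg hP.le (sub_nonneg.2 hp1)) hpos
        nlinarith
      rcases (ν2.nonneg P).eq_or_lt with h0 | h0
      · refine ⟨ν2, h2, ?_⟩
        rw [← h0] at hle
        linarith
      · obtain ⟨ν3, h3⟩ := exists_full_step ν2 ρ P
        refine ⟨ν3, h2.tail ⟨one_pos, le_rfl, P, ρ, h0, hPρ, h3⟩, ?_⟩
        rw [exp_step h3 h, ← hd]
        linarith

theorem internal_rtg {Proc Act : Type} (step : Proc → Act → FinDist Proc → Prop) (tau : Act)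
    (π : List (Act × ℝ)) : ∀ (μ ν : FinDist Proc), (∀ s ∈ π, s.1 = tau) → DSeq step μ π ν →
    Relation.ReflTransGen (fun a b => ∃ p, DStep step a tau p b) μ ν := by
  induction π with
  | nil => intro μ ν _ h; cases h; exact .refl
  | cons s π ih =>
    rintro μ ν hs ⟨μ', h1, h2⟩
    rw [hs s (by simp)] at h1
    exact .head ⟨_, h1⟩ (ih _ _ (fun t ht => hs t (by simp [ht])) h2)

theorem rtg_degenerate {Proc Act : Type} (step : Proc → Act → FinDist Proc → Prop) (tau : Act)
    {μ ν : FinDist Proc}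
    (hs : Relation.ReflTransGen (fun a b => DStep step a tau 1 b) μ ν) :
    Degenerate step tau μ ν := by
  induction hs using Relation.ReflTransGen.head_induction_on with
  | refl => exact ⟨[], by simp, rfl⟩
  | head h1 _ ih =>
    obtain ⟨π, hπ, h2⟩ := ih
    refine ⟨(tau, 1) :: π, ?_, _, h1, h2⟩
    intro s hs
    rcases List.mem_cons.1 hs with rfl | hs
    · exact ⟨rfl, rfl⟩
    · exact hπ s hs

theorem mass_eq_exp {Proc : Type} (μ : FinDist Proc) (φ : Set Proc) :
    μ.mass φ = ∑ᶠ Q, μ.toFun Q * (if Q ∈ φ then 1 else 0) := by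
  unfold FinDist.mass
  refine finsum_congr fun Q => ?_
  by_cases hQ : Q ∈ φ <;> simp [hQ]

/-- Any internal transition sequence can be lower and upper
approximated, with respect to the satisfaction probability of `φ`, by internal
transition sequences with degenerate witnesses. -/
theorem bounded_by_degenerate_witness
    {Proc Act : Type} (step : Proc → Act → FinDist Proc → Prop) (tau : Act)
    (φ : Set Proc) (μ ν : FinDist Proc) (h : Internal step tau μ ν) :
    ∃ ν1 ν2 : FinDist Proc,
      Degenerate step tau μ ν1 ∧ Degenerate step tau μ ν2 ∧
      ν1.mass φ ≤ ν.mass φ ∧ ν.mass φ ≤ ν2.mass φ := by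
  obtain ⟨π, hπ, hseq⟩ := h
  have hr := internal_rtg step tau π μ ν hπ hseq
  obtain ⟨ν2, h2, hle2⟩ := upper_aux step tau hr (fun Q => if Q ∈ φ then 1 else 0)
  obtain ⟨ν1, h1, hle1⟩ := upper_aux step tau hr (fun Q => -(if Q ∈ φ then 1 else 0))
  refine ⟨ν1, ν2, rtg_degenerate step tau h1, rtg_degenerate step tau h2, ?_, ?_⟩
  · simp only [mul_neg, finsum_neg_distrib] at hle1
    rw [mass_eq_exp, mass_eq_exp]
    linarith
  · rw [mass_eq_exp, mass_eq_exp]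
    exact hle2
end

section
/- For every distribution μ ∈ D(Proc) and every predicate φ ⊆ Proc: χmay_φ(μ) = sup{ ν(φ) : μ →τ* ν } and χfair_φ(μ) = inf{ sup O^ν_φ : μ →τ* ν }, i.e., both characteristics can be computed using only internal transition sequences with degenerate witnesses. -/
open scoped Classical

/-- The may characteristic `χmay_φ(μ) = sup O^μ_φ`. -/
noncomputable def chiMay {Proc Act : Type} (step : Proc → Act → FinDist Proc → Prop)
    (tau : Act) (φ : Set Proc) (μ : FinDist Proc) : ℝ :=
  sSup (Outcomes step tau φ μ)

/-- The fair characteristic `χfair_φ(μ) = inf { sup O^ν_φ : μ ⇝ ν }`. -/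
noncomputable def chiFair {Proc Act : Type} (step : Proc → Act → FinDist Proc → Prop)
    (tau : Act) (φ : Set Proc) (μ : FinDist Proc) : ℝ :=
  sInf {x | ∃ ν, Internal step tau μ ν ∧ x = sSup (Outcomes step tau φ ν)}

namespace FinDist

theorem supp_mul {α : Type} (c : ℝ) (f : α → ℝ) :
    (Function.support fun Q => c * f Q) ⊆ Function.support f :=
  fun _ hQ => right_ne_zero_of_mul hQ

theorem ext' {α : Type} {a b : FinDist α} (h : ∀ Q, a.toFun Q = b.toFun Q) : a = b := by
  cases a; cases b
  congr
  exact funext h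

/-- Convex combination `c·a + (1-c)·b`. -/
noncomputable def mix {α : Type} (c : ℝ) (h0 : 0 ≤ c) (h1 : c ≤ 1) (a b : FinDist α) :
    FinDist α where
  toFun Q := c * a.toFun Q + (1 - c) * b.toFun Q
  nonneg Q := by
    have := mul_nonneg h0 (a.nonneg Q)
    have := mul_nonneg (sub_nonneg.2 h1) (b.nonneg Q)
    linarith
  finite_support := by
    refine (a.finite_support.union b.finite_support).subset ?_
    intro Q hQ
    by_contra hn
    simp only [Set.mem_union, Function.mem_support, not_or, not_not] at hn
    simp [hn.1, hn.2] at hQ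
  sum_one := by
    rw [finsum_add_distrib, ← mul_finsum, ← mul_finsum, a.sum_one, b.sum_one]
    · ring
    · exact a.finite_support.subset (supp_mul _ _)
    · exact b.finite_support.subset (supp_mul _ _)

/-- Move an amount `c` of mass from `P` to `ρ`. -/
noncomputable def upd {α : Type} (c : ℝ) (P : α) (ρ a : FinDist α) (h0 : 0 ≤ c)
    (h1 : c ≤ a.toFun P) : FinDist α where
  toFun Q := a.toFun Q + c * (ρ.toFun Q - (if Q = P then 1 else 0))
  nonneg Q := by
    have := mul_nonneg h0 (ρ.nonneg Q)
    have := a.nonneg Q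
    split_ifs with h
    · subst h; linarith
    · linarith
  finite_support := by
    refine ((a.finite_support.union ρ.finite_support).union (Set.finite_singleton P)).subset ?_
    intro Q hQ
    by_contra hn
    simp only [Set.mem_union, Function.mem_support, not_or, not_not, Set.mem_singleton_iff] at hn
    simp [hn.1, hn.2] at hQ
  sum_one := by
    have hs : (Function.support fun Q : α => if Q = P then (1 : ℝ) else 0).Finite := by
      refine (Set.finite_singleton P).subset ?_
      intro Q hQ
      by_contra hn
      simp at hn
      simp [hn] at hQ
    have hd : (Function.support fun Q : α => ρ.toFun Q - if Q = P then (1 : ℝ) else 0).Finite :=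
      (ρ.finite_support.union hs).subset (Function.support_sub _ _)
    rw [finsum_add_distrib a.finite_support
      (hd.subset (supp_mul _ _)), ← mul_finsum,
      finsum_sub_distrib ρ.finite_support hs, a.sum_one, ρ.sum_one,
      finsum_eq_single _ P (by intro x hx; simp [hx])]
    simp

theorem mass_mix {α : Type} (c : ℝ) (h0 : 0 ≤ c) (h1 : c ≤ 1) (a b : FinDist α) (φ : Set α) :
    (mix c h0 h1 a b).mass φ = c * a.mass φ + (1 - c) * b.mass φ := by
  have ha := a.finite_support
  have hb := b.finite_support
  unfold mass mix
  simp only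
  rw [finsum_mem_add_distrib', ← mul_finsum_mem, ← mul_finsum_mem]
  · exact (ha.subset (supp_mul _ _)).subset Set.inter_subset_right
  · exact (hb.subset (supp_mul _ _)).subset Set.inter_subset_right

theorem mass_eq_sum {α : Type} (a : FinDist α) (φ : Set α) :
    a.mass φ = ∑ Q ∈ a.finite_support.toFinset, φ.indicator a.toFun Q := by
  unfold mass
  rw [finsum_mem_def]
  refine finsum_eq_sum_of_support_subset _ ?_
  simp [Set.support_indicator]

theorem mass_nonneg {α : Type} (a : FinDist α) (φ : Set α) : 0 ≤ a.mass φ := by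
  rw [mass_eq_sum]
  exact Finset.sum_nonneg fun Q _ => Set.indicator_nonneg (fun _ _ => a.nonneg _) Q

theorem mass_le_one {α : Type} (a : FinDist α) (φ : Set α) : a.mass φ ≤ 1 := by
  have h : ∑ Q ∈ a.finite_support.toFinset, a.toFun Q = 1 := by
    rw [← a.sum_one]
    exact (finsum_eq_sum_of_support_subset _ (by simp)).symm
  rw [mass_eq_sum, ← h]
  exact Finset.sum_le_sum fun Q _ => Set.indicator_le_self' (fun _ _ => a.nonneg _) Q

theorem mix_comm {α : Type} (c : ℝ) (h0 : 0 ≤ c) (h1 : c ≤ 1) (a b : FinDist α) :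
    mix c h0 h1 a b = mix (1 - c) (by linarith) (by linarith) b a :=
  ext' fun Q => by simp only [mix]; ring

end FinDist

open FinDist

section Aux

variable {Proc Act : Type} {step : Proc → Act → FinDist Proc → Prop} {tau : Act}

theorem Internal.refl (μ : FinDist Proc) : Internal step tau μ μ := ⟨[], by simp, rfl⟩

theorem Degenerate.refl (μ : FinDist Proc) : Degenerate step tau μ μ := ⟨[], by simp, rfl⟩

theorem Internal.head {μ μ' ν : FinDist Proc} {p : ℝ} (h : DStep step μ tau p μ')
    (h' : Internal step tau μ' ν) : Internal step tau μ ν := by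
  obtain ⟨π, hπ, hs⟩ := h'
  exact ⟨(tau, p) :: π, by simpa using hπ, μ', h, hs⟩

theorem Degenerate.head {μ μ' ν : FinDist Proc} (h : DStep step μ tau 1 μ')
    (h' : Degenerate step tau μ' ν) : Degenerate step tau μ ν := by
  obtain ⟨π, hπ, hs⟩ := h'
  exact ⟨(tau, 1) :: π, by simpa using hπ, μ', h, hs⟩

theorem Degenerate.internal {μ ν : FinDist Proc} (h : Degenerate step tau μ ν) :
    Internal step tau μ ν := by
  obtain ⟨π, hπ, hs⟩ := h
  exact ⟨π, fun s hs => (hπ s hs).1, hs⟩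

theorem Internal.induct {C : FinDist Proc → FinDist Proc → Prop} (h0 : ∀ μ, C μ μ)
    (h1 : ∀ μ p μ' ν, DStep step μ tau p μ' → Internal step tau μ' ν → C μ' ν → C μ ν)
    {μ ν : FinDist Proc} (h : Internal step tau μ ν) : C μ ν := by
  obtain ⟨π, hπ, hs⟩ := h
  induction π generalizing μ with
  | nil => cases hs; exact h0 _
  | cons s π ih =>
    obtain ⟨μ', hst, hs⟩ := hs
    rw [hπ s (by simp)] at hst
    have hπ' : ∀ s ∈ π, s.1 = tau := fun t ht => hπ t (by simp [ht])
    exact h1 _ _ _ _ hst ⟨π, hπ', hs⟩ (ih hπ' hs)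

theorem Degenerate.induct {C : FinDist Proc → FinDist Proc → Prop} (h0 : ∀ μ, C μ μ)
    (h1 : ∀ μ μ' ν, DStep step μ tau 1 μ' → C μ' ν → C μ ν)
    {μ ν : FinDist Proc} (h : Degenerate step tau μ ν) : C μ ν := by
  obtain ⟨π, hπ, hs⟩ := h
  induction π generalizing μ with
  | nil => cases hs; exact h0 _
  | cons s π ih =>
    obtain ⟨μ', hst, hs⟩ := hs
    rw [(hπ s (by simp)).1, (hπ s (by simp)).2] at hst
    have hπ' : ∀ s ∈ π, s.1 = tau ∧ s.2 = 1 := fun t ht => hπ t (by simp [ht])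
    exact h1 _ _ _ hst (ih hπ' hs)

theorem Internal.trans {μ ν ξ : FinDist Proc} (h : Internal step tau μ ν) :
    Internal step tau ν ξ → Internal step tau μ ξ :=
  Internal.induct (C := fun μ ν => Internal step tau ν ξ → Internal step tau μ ξ)
    (fun _ h => h) (fun _ _ _ _ hst _ ih h => (ih h).head hst) h

/-- Internal sequences can be run inside a convex combination. -/
theorem Internal.mix_left {μ ν : FinDist Proc} (h : Internal step tau μ ν) (σ : FinDist Proc)
    (c : ℝ) (h0 : 0 ≤ c) (h1 : c ≤ 1) :
    Internal step tau (mix c h0 h1 μ σ) (mix c h0 h1 ν σ) := by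
  rcases h0.eq_or_lt with rfl | hc
  · have : mix 0 h0 h1 μ σ = mix 0 h0 h1 ν σ := ext' fun Q => by simp [mix]
    rw [this]
    exact Internal.refl _
  refine Internal.induct (C := fun μ ν =>
    Internal step tau (mix c h0 h1 μ σ) (mix c h0 h1 ν σ)) (fun _ => Internal.refl _) ?_ h
  rintro μ p μ' ν ⟨hp0, hp1, P, ρ, hP, hst, hQ⟩ - ih
  have hm1 : 0 < c * μ.toFun P := mul_pos hc hP
  have hm2 : 0 ≤ (1 - c) * σ.toFun P := mul_nonneg (by linarith) (σ.nonneg P)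
  have hm : 0 < c * μ.toFun P + (1 - c) * σ.toFun P := by linarith
  refine ih.head (p := c * μ.toFun P * p / (c * μ.toFun P + (1 - c) * σ.toFun P))
    ⟨by positivity, ?_, P, ρ, hm, hst, ?_⟩
  · rw [div_le_one hm]
    nlinarith
  · intro Q
    simp only [mix]
    rw [hQ Q, mul_div_cancel₀ _ hm.ne']
    ring

theorem Internal.mix {a a' b b' : FinDist Proc} (ha : Internal step tau a a')
    (hb : Internal step tau b b') (c : ℝ) (h0 : 0 ≤ c) (h1 : c ≤ 1) :
    Internal step tau (mix c h0 h1 a b) (mix c h0 h1 a' b') := by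
  refine (ha.mix_left b c h0 h1).trans ?_
  rw [mix_comm c h0 h1 a' b, mix_comm c h0 h1 a' b']
  exact hb.mix_left _ _ _ _

/-- Firing a transition fully, skipping it when the source carries no mass. -/
theorem fire {P : Proc} {ρ : FinDist Proc} (hst : step P tau ρ) (a : FinDist Proc)
    {ν : FinDist Proc}
    (h : Degenerate step tau (upd (a.toFun P) P ρ a (a.nonneg P) le_rfl) ν) :
    Degenerate step tau a ν := by
  rcases (a.nonneg P).eq_or_lt with h0 | h0
  · have : upd (a.toFun P) P ρ a (a.nonneg P) le_rfl = a :=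
      ext' fun Q => by simp [upd, ← h0]
    rwa [this] at h
  · exact h.head ⟨one_pos, le_rfl, P, ρ, h0, hst, fun Q => by simp [upd]⟩

/-- Degenerate sequences from a convex combination split. -/
theorem Degenerate.split {μ ν : FinDist Proc} (h : Degenerate step tau μ ν)
    (c : ℝ) (h0 : 0 ≤ c) (h1 : c ≤ 1) : ∀ a b : FinDist Proc, μ = FinDist.mix c h0 h1 a b →
    ∃ a' b', Degenerate step tau a a' ∧ Degenerate step tau b b' ∧
      ν = FinDist.mix c h0 h1 a' b' := by
  refine Degenerate.induct (C := fun μ ν => ∀ a b : FinDist Proc, μ = FinDist.mix c h0 h1 a b →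
    ∃ a' b', Degenerate step tau a a' ∧ Degenerate step tau b b' ∧
      ν = FinDist.mix c h0 h1 a' b') ?_ ?_ h
  · intro μ a b h
    exact ⟨a, b, Degenerate.refl _, Degenerate.refl _, h⟩
  · rintro μ μ' ν ⟨-, -, P, ρ, hP, hst, hQ⟩ ih a b rfl
    obtain ⟨a', b', ha, hb, hν⟩ := ih (upd (a.toFun P) P ρ a (a.nonneg P) le_rfl)
      (upd (b.toFun P) P ρ b (b.nonneg P) le_rfl) (ext' fun Q => by
        rw [hQ Q]
        simp only [FinDist.mix, upd]
        ring)
    exact ⟨a', b', fire hst a ha, fire hst b hb, hν⟩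

/-- A quasi-concave functional is minimised along degenerate sequences. -/
theorem exists_degenerate_le (F : FinDist Proc → ℝ)
    (hF : ∀ c h0 h1 a b, F a ≤ F (FinDist.mix c h0 h1 a b) ∨ F b ≤ F (FinDist.mix c h0 h1 a b))
    {μ ν : FinDist Proc} (h : Internal step tau μ ν) :
    ∃ ν', Degenerate step tau μ ν' ∧ F ν' ≤ F ν := by
  refine Internal.induct (C := fun μ ν => ∃ ν', Degenerate step tau μ ν' ∧ F ν' ≤ F ν)
    (fun μ => ⟨μ, Degenerate.refl _, le_rfl⟩) ?_ h
  rintro μ p μ' ν ⟨hp0, hp1, P, ρ, hP, hst, hQ⟩ - ⟨ν', hd, hle⟩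
  obtain ⟨a', b', ha, hb, rfl⟩ := hd.split p hp0.le hp1
    (upd (μ.toFun P) P ρ μ (μ.nonneg P) le_rfl) μ (ext' fun Q => by
      rw [hQ Q]
      simp only [FinDist.mix, upd]
      ring)
  rcases hF p hp0.le hp1 a' b' with h | h
  · exact ⟨a', fire hst μ ha, h.trans hle⟩
  · exact ⟨b', hb, h.trans hle⟩

theorem outcomes_bdd (φ : Set Proc) (μ : FinDist Proc) :
    BddAbove (Outcomes step tau φ μ) := by
  refine ⟨1, ?_⟩
  rintro x ⟨ν, -, rfl⟩
  exact ν.mass_le_one φ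

theorem outcomes_nonempty (φ : Set Proc) (μ : FinDist Proc) :
    (Outcomes step tau φ μ).Nonempty := ⟨_, μ, Internal.refl _, rfl⟩

theorem min_le_comb {x y c : ℝ} (h0 : 0 ≤ c) (h1 : c ≤ 1) : min x y ≤ c * x + (1 - c) * y := by
  have := mul_le_mul_of_nonneg_left (min_le_left x y) h0
  have := mul_le_mul_of_nonneg_left (min_le_right x y) (sub_nonneg.2 h1)
  linarith

theorem sup_quasi (φ : Set Proc) (c : ℝ) (h0 : 0 ≤ c) (h1 : c ≤ 1) (a b : FinDist Proc) :
    sSup (Outcomes step tau φ a) ≤ sSup (Outcomes step tau φ (FinDist.mix c h0 h1 a b)) ∨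
    sSup (Outcomes step tau φ b) ≤ sSup (Outcomes step tau φ (FinDist.mix c h0 h1 a b)) := by
  by_contra! hn
  obtain ⟨x, ⟨a', ha, rfl⟩, hx⟩ := exists_lt_of_lt_csSup (outcomes_nonempty φ a) hn.1
  obtain ⟨y, ⟨b', hb, rfl⟩, hy⟩ := exists_lt_of_lt_csSup (outcomes_nonempty φ b) hn.2
  have hm : (FinDist.mix c h0 h1 a' b').mass φ ∈
      Outcomes step tau φ (FinDist.mix c h0 h1 a b) := ⟨_, ha.mix hb c h0 h1, rfl⟩
  have h := le_csSup (outcomes_bdd φ _) hm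
  rw [mass_mix] at h
  exact absurd ((lt_min hx hy).trans_le (min_le_comb h0 h1)) (not_lt.2 h)

end Aux

/-- Both characteristics can be computed using only internal
transition sequences with degenerate witnesses. -/
theorem characteristics_by_degenerate_witnesses
    {Proc Act : Type} (step : Proc → Act → FinDist Proc → Prop) (tau : Act)
    (φ : Set Proc) (μ : FinDist Proc) :
    chiMay step tau φ μ = sSup {x | ∃ ν, Degenerate step tau μ ν ∧ x = ν.mass φ} ∧
    chiFair step tau φ μ =
      sInf {x | ∃ ν, Degenerate step tau μ ν ∧ x = sSup (Outcomes step tau φ ν)} := by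
  constructor
  · refine le_antisymm (csSup_le (outcomes_nonempty φ μ) ?_)
      (csSup_le_csSup (outcomes_bdd φ μ) ⟨_, μ, Degenerate.refl _, rfl⟩ ?_)
    · rintro x ⟨ν, hν, rfl⟩
      obtain ⟨ν', hd, hle⟩ := exists_degenerate_le (fun ν => - ν.mass φ) (by
        intro c h0 h1 a b
        by_contra! hn
        have := min_le_comb (x := - a.mass φ) (y := - b.mass φ) h0 h1
        rw [mass_mix] at hn
        have := lt_min hn.1 hn.2
        linarith) hν
      refine (neg_le_neg_iff.1 hle).trans (le_csSup ⟨1, ?_⟩ ⟨ν', hd, rfl⟩)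
      rintro x ⟨ν, -, rfl⟩
      exact ν.mass_le_one φ
    · rintro x ⟨ν, hν, rfl⟩
      exact ⟨ν, hν.internal, rfl⟩
  · have hbd : ∀ ν, 0 ≤ sSup (Outcomes step tau φ ν) := fun ν =>
      (ν.mass_nonneg φ).trans (le_csSup (outcomes_bdd φ ν) ⟨ν, Internal.refl _, rfl⟩)
    unfold chiFair
    refine le_antisymm (csInf_le_csInf ⟨0, ?_⟩ ⟨_, μ, Degenerate.refl _, rfl⟩ ?_)
      (le_csInf ⟨_, μ, Internal.refl _, rfl⟩ ?_)
    · rintro x ⟨ν, -, rfl⟩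
      exact hbd ν
    · rintro x ⟨ν, hν, rfl⟩
      exact ⟨ν, hν.internal, rfl⟩
    · rintro x ⟨ν, hν, rfl⟩
      obtain ⟨ν', hd, hle⟩ := exists_degenerate_le
        (fun ν => sSup (Outcomes step tau φ ν)) (sup_quasi φ) hν
      refine le_trans (csInf_le ⟨0, ?_⟩ ⟨ν', hd, rfl⟩) hle
      rintro x ⟨ν, -, rfl⟩
      exact hbd ν
end
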